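/- Let Γ be a countable discrete group, A ⊆ Γ a finite subset with e ∈ A, and 0 < δ < 1/2. Then there exists a finite IRE ρ on Γ such that for ρ-almost every r, the class [e]_r is contained in gA for some g ∈ Γ, and ρ({r ∈ E : |[e]_r| ≥ (1−2δ)²|A|}) ≥ (δ − δ²)·4δ²·(1−2δ)². -/

import Mathlib

open MeasureTheory Filter Topology

/-- A function `r : Γ × Γ → Bool` codes an equivalence relation on `Γ`. -/
def IsEqRel {Γ : Type*} (r : Γ × Γ → Bool) : Prop :=
  (∀ x, r (x, x) = true) ∧ (∀ x y, r (x, y) = true → r (y, x) = true) ∧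
    (∀ x y z, r (x, y) = true → r (y, z) = true → r (x, z) = true)

/-- The space `E` of equivalence relations on `Γ`, as a subspace of `{0,1}^{Γ×Γ}`. -/
abbrev EqRelSpace (Γ : Type*) : Type _ := ↥{r : Γ × Γ → Bool | IsEqRel r}

variable {Γ : Type*} [Group Γ]

/-- The left shift action of `Γ` on the space of equivalence relations:
`(γ·r)(x,y) = r(γ⁻¹x, γ⁻¹y)`. -/
def shiftE (γ : Γ) (r : EqRelSpace Γ) : EqRelSpace Γ :=
  ⟨fun p => r.1 (γ⁻¹ * p.1, γ⁻¹ * p.2),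
    ⟨fun _ => r.2.1 _, fun _ _ h => r.2.2.1 _ _ h, fun _ _ _ h h' => r.2.2.2 _ _ _ h h'⟩⟩

/-- The `r`-class of `g ∈ Γ`. -/
def classOf (r : EqRelSpace Γ) (g : Γ) : Set Γ := {h | r.1 (g, h) = true}

/-- An invariant random equivalence relation: a Borel probability measure on `E`
invariant under the left shift action. -/
def IsIRE (ρ : ProbabilityMeasure (EqRelSpace Γ)) : Prop :=
  ∀ γ : Γ, ρ.toMeasure.map (shiftE γ) = ρ.toMeasure

/-- A finite IRE: almost every equivalence relation has all classes finite. -/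
def IsFIRE {Γ : Type*} [Group Γ] (ρ : ProbabilityMeasure (EqRelSpace Γ)) : Prop :=
  IsIRE ρ ∧ ∀ᵐ r ∂ρ.toMeasure, ∀ g : Γ, (classOf r g).Finite

open ProbabilityTheory
open scoped unitInterval

/-- Among the translates `hA` with `h` in the random set coded by `S`, the translate `gA` is the
only one that contains `x`. -/
def IsUniqueCenter (A : Finset Γ) (S : Γ → Bool) (x g : Γ) : Prop :=
  S g = true ∧ g⁻¹ * x ∈ A ∧ ∀ h, S h = true → h⁻¹ * x ∈ A → h = g

/-- Two points are related when they are equal or covered exactly once, by the same translate. -/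
def SameCenter (A : Finset Γ) (S : Γ → Bool) (x y : Γ) : Prop :=
  x = y ∨ ∃ g, IsUniqueCenter A S x g ∧ IsUniqueCenter A S y g

/-- The left shift on subsets of `Γ`, coded by their indicator functions. -/
def shiftSet (γ : Γ) (S : Γ → Bool) : Γ → Bool := fun x => S (γ⁻¹ * x)

lemma IsUniqueCenter.eq {A : Finset Γ} {S : Γ → Bool} {x g h : Γ}
    (hg : IsUniqueCenter A S x g) (hh : IsUniqueCenter A S x h) : g = h :=
  hh.2.2 g hg.1 hg.2.1

lemma isUniqueCenter_shiftSet (A : Finset Γ) (S : Γ → Bool) (γ x g : Γ) :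
    IsUniqueCenter A (shiftSet γ S) x g ↔ IsUniqueCenter A S (γ⁻¹ * x) (γ⁻¹ * g) := by
  simp only [IsUniqueCenter, shiftSet]
  refine and_congr Iff.rfl (and_congr (by simp [mul_assoc]) ⟨fun H h h1 h2 => ?_,
    fun H h h1 h2 => ?_⟩)
  · rw [← H (γ * h) (by simpa using h1) (by simpa [mul_assoc] using h2)]
    simp
  · exact mul_left_cancel (H (γ⁻¹ * h) h1 (by simpa [mul_assoc] using h2))

open Classical in
/-- The equivalence relation determined by a subset of `Γ`. -/
noncomputable def centerRel (A : Finset Γ) (S : Γ → Bool) : EqRelSpace Γ :=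
  ⟨fun p => decide (SameCenter A S p.1 p.2), by
    refine ⟨fun x => by simp [SameCenter], fun x y h => ?_, fun x y z h h' => ?_⟩
    · simp only [decide_eq_true_eq] at h ⊢
      rcases h with h | ⟨g, h1, h2⟩
      · exact Or.inl h.symm
      · exact Or.inr ⟨g, h2, h1⟩
    · simp only [decide_eq_true_eq] at h h' ⊢
      rcases h with rfl | ⟨g, h1, h2⟩
      · exact h'
      · rcases h' with rfl | ⟨k, h3, h4⟩
        · exact Or.inr ⟨g, h1, h2⟩
        · exact Or.inr ⟨g, h1, (h2.eq h3) ▸ h4⟩⟩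

lemma mem_classOf_centerRel (A : Finset Γ) (S : Γ → Bool) (x y : Γ) :
    y ∈ classOf (centerRel A S) x ↔ SameCenter A S x y := by
  simp [classOf, centerRel]

lemma shiftE_centerRel (A : Finset Γ) (γ : Γ) (S : Γ → Bool) :
    shiftE γ (centerRel A S) = centerRel A (shiftSet γ S) := by
  classical
  refine Subtype.ext (funext fun p => ?_)
  simp only [shiftE, centerRel, decide_eq_decide, SameCenter, isUniqueCenter_shiftSet,
    mul_right_inj]
  refine or_congr Iff.rfl ⟨fun ⟨g, hg⟩ => ⟨γ * g, by simpa using hg⟩, fun ⟨g, hg⟩ => ⟨_, hg⟩⟩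

lemma classOf_centerRel_subset {A : Finset Γ} (hA : (1 : Γ) ∈ A) (S : Γ → Bool) (x : Γ) :
    ∃ g : Γ, classOf (centerRel A S) x ⊆ (fun y => g * y) '' (↑A : Set Γ) := by
  by_cases hx : ∃ g, IsUniqueCenter A S x g
  · obtain ⟨g, hg⟩ := hx
    refine ⟨g, fun y hy => ?_⟩
    have hgy : IsUniqueCenter A S y g := by
      rcases (mem_classOf_centerRel A S x y).1 hy with rfl | ⟨h, h1, h2⟩
      · exact hg
      · exact (h1.eq hg) ▸ h2
    exact ⟨g⁻¹ * y, hgy.2.1, by simp⟩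
  · refine ⟨x, fun y hy => ?_⟩
    rcases (mem_classOf_centerRel A S x y).1 hy with rfl | ⟨h, h1, -⟩
    · exact ⟨1, hA, by simp⟩
    · exact absurd ⟨h, h1⟩ hx

lemma measurableSet_isUniqueCenter [Countable Γ] (A : Finset Γ) (x g : Γ) :
    MeasurableSet {S : Γ → Bool | IsUniqueCenter A S x g} := by
  have hS (h : Γ) : MeasurableSet {S : Γ → Bool | S h = true} :=
    measurableSet_eq_fun (measurable_pi_apply h) measurable_const
  refine (hS g).inter ((MeasurableSet.const _).inter ?_)
  refine MeasurableSet.congr (s := ⋂ h, {S : Γ → Bool | S h = true → h⁻¹ * x ∈ A → h = g})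
    (MeasurableSet.iInter fun h => ?_) (by ext S; simp; rfl)
  have : {S : Γ → Bool | S h = true → h⁻¹ * x ∈ A → h = g} =
      {S | S h = true}ᶜ ∪ {_S | h⁻¹ * x ∈ A → h = g} := by
    ext S
    simp [imp_iff_not_or]
  rw [this]
  exact (hS h).compl.union (MeasurableSet.const _)

lemma measurable_centerRel [Countable Γ] (A : Finset Γ) : Measurable (centerRel A) := by
  refine Measurable.subtype_mk (measurable_pi_iff.2 fun p => measurable_to_bool ?_)
  have : (fun S : Γ → Bool => (centerRel A S).1 p) ⁻¹' {true} =
      {_S | p.1 = p.2} ∪ ⋃ g, ({S | IsUniqueCenter A S p.1 g} ∩ {S | IsUniqueCenter A S p.2 g}) := by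
    ext S
    refine (mem_classOf_centerRel A S p.1 p.2).trans ?_
    simp [SameCenter]
  exact this ▸ (MeasurableSet.const _).union (MeasurableSet.iUnion fun g =>
    (measurableSet_isUniqueCenter A _ g).inter (measurableSet_isUniqueCenter A _ g))

lemma measurable_shiftSet (γ : Γ) : Measurable (shiftSet γ) :=
  measurable_pi_iff.2 fun x => measurable_pi_apply (γ⁻¹ * x)

lemma measurable_shiftE (γ : Γ) : Measurable (shiftE γ) :=
  Measurable.subtype_mk (measurable_pi_iff.2 fun p =>
    (measurable_pi_apply (γ⁻¹ * p.1, γ⁻¹ * p.2)).comp measurable_subtype_coe)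

/-- The law of a random subset of `Γ` that contains each point independently with
probability `p`. -/
noncomputable def percolation (Γ : Type*) (p : I) : Measure (Γ → Bool) :=
  Measure.infinitePi fun _ => bernoulliMeasure true false p

instance (Γ : Type*) (p : I) : IsProbabilityMeasure (percolation Γ p) := by
  unfold percolation
  infer_instance

lemma percolation_map_shiftSet (p : I) (γ : Γ) :
    (percolation Γ p).map (shiftSet γ) = percolation Γ p := by
  have h := Measure.infinitePi_map_piCongrLeft (X := fun _ : Γ => Bool)
    (fun _ : Γ => bernoulliMeasure true false p) (Equiv.mulLeft γ)
  rw [percolation]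
  convert h using 2
  ext S x
  obtain ⟨y, rfl⟩ := (Equiv.mulLeft γ).surjective x
  rw [MeasurableEquiv.coe_piCongrLeft, Equiv.piCongrLeft_apply_apply]
  simp [shiftSet]

lemma percolation_real_pi {ι : Type*} (p : I) (s : Finset ι) (t : ι → Set Bool) :
    (percolation ι p).real (Set.pi s t) = ∏ i ∈ s, (bernoulliMeasure true false p).real (t i) := by
  rw [Measure.real, percolation, Measure.infinitePi_pi _ fun i _ => MeasurableSet.of_discrete,
    ENNReal.toReal_prod]
  rfl

lemma percolation_real_mem {ι : Type*} (p : I) (g : ι) :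
    (percolation ι p).real {S | S g = true} = p := by
  have := percolation_real_pi p {g} fun _ => {true}
  rw [Finset.prod_singleton, bernoulliMeasure_real_apply_of_mem_of_notMem _ (by simp) (by simp)
    (by simp)] at this
  rw [← this]
  congr 1
  ext S
  simp

lemma percolation_real_isUniqueCenter (p : I) {A : Finset Γ} {a : Γ} (ha : a ∈ A) :
    (percolation Γ p).real {S | IsUniqueCenter A S a 1} = p * (1 - p : ℝ) ^ (A.card - 1) := by
  classical
  have hpi : {S : Γ → Bool | IsUniqueCenter A S a 1} =
      Set.pi ↑(A.image fun b => a * b⁻¹) fun g => if g = 1 then {true} else {false} := by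
    ext S
    simp only [IsUniqueCenter, Set.mem_ofPred_eq, Set.mem_pi, Finset.coe_image, Set.mem_image,
      Finset.mem_coe, forall_exists_index, and_imp, forall_apply_eq_imp_iff₂]
    constructor
    · rintro ⟨h1, -, h2⟩ b hb
      split_ifs with h
      · simpa [h] using h1
      · by_contra h3
        exact h (h2 _ (by simpa using h3) (by simpa using hb))
    · intro H
      refine ⟨by simpa using H a ha, by simpa using ha, fun h h1 h2 => ?_⟩
      by_contra h3
      have := H _ h2
      simp [h3, h1] at this
  have hinj : Function.Injective fun b : Γ => a * b⁻¹ := fun b c h => by simpa using h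
  have h1 : (1 : Γ) ∈ A.image fun b => a * b⁻¹ := Finset.mem_image.2 ⟨a, ha, by simp⟩
  rw [hpi, percolation_real_pi, ← Finset.mul_prod_erase _ _ h1, if_pos rfl,
    bernoulliMeasure_real_apply_of_mem_of_notMem _ (by simp) (by simp) (by simp)]
  congr 1
  rw [Finset.prod_congr rfl fun x hx => by
    rw [if_neg (Finset.ne_of_mem_erase hx), bernoulliMeasure_real_apply_of_notMem_of_mem _
      (by simp) (by simp) (by simp)]]
  rw [Finset.prod_const, Finset.card_erase_of_mem h1, Finset.card_image_of_injective _ hinj]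

open Classical in
/-- The number of points of `A` that are covered by `A` and by no other translate. -/
noncomputable def coreCard (A : Finset Γ) (S : Γ → Bool) : ℕ :=
  (A.filter fun a => IsUniqueCenter A S a 1).card

lemma measurable_coreCard [Countable Γ] (A : Finset Γ) : Measurable (coreCard A) := by
  classical
  have : coreCard A = fun S => ∑ a ∈ A, if IsUniqueCenter A S a 1 then 1 else 0 := by
    ext S
    simp [coreCard]
  rw [this]
  exact Finset.measurable_fun_sum _ fun a _ =>
    Measurable.ite (measurableSet_isUniqueCenter A a 1) measurable_const measurable_const

lemma measurableSet_le_coreCard [Countable Γ] (A : Finset Γ) (t : ℝ) :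
    MeasurableSet {S : Γ → Bool | t ≤ coreCard A S} :=
  measurableSet_le measurable_const (measurable_from_nat.comp (measurable_coreCard A))

lemma sum_real_isUniqueCenter_le [Countable Γ] (μ : Measure (Γ → Bool)) [IsProbabilityMeasure μ]
    (A : Finset Γ) {t : ℝ} (ht : 0 ≤ t) :
    ∑ a ∈ A, μ.real {S | IsUniqueCenter A S a 1} ≤
      ∑ a ∈ A, μ.real ({S | IsUniqueCenter A S a 1} ∩ {S | t ≤ coreCard A S}) +
        t * μ.real {S | S 1 = true} := by
  classical
  have hD (a : Γ) := measurableSet_isUniqueCenter A a 1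
  have hL := measurableSet_le_coreCard A t
  have hC : MeasurableSet {S : Γ → Bool | S 1 = true} :=
    measurableSet_eq_fun (measurable_pi_apply 1) measurable_const
  have hint {s : Set (Γ → Bool)} (hs : MeasurableSet s) :
      Integrable (s.indicator fun _ => (1 : ℝ)) μ := (integrable_const _).indicator hs
  have key {s : Set (Γ → Bool)} (hs : MeasurableSet s) :
      μ.real s = ∫ S, s.indicator (fun _ => (1 : ℝ)) S ∂μ := by
    rw [integral_indicator hs]; simp
  simp only [key (hD _), key ((hD _).inter hL), key hC]
  rw [← integral_finsetSum _ fun a _ => hint (hD a),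
    ← integral_finsetSum _ fun a _ => hint ((hD a).inter hL), ← integral_const_mul,
    ← integral_add (integrable_finsetSum _ fun a _ => hint ((hD a).inter hL))
      ((hint hC).const_mul t)]
  refine integral_mono (integrable_finsetSum _ fun a _ => hint (hD a))
    ((integrable_finsetSum _ fun a _ => hint ((hD a).inter hL)).add ((hint hC).const_mul t))
    fun S => ?_
  have hsum : ∑ a ∈ A, {S | IsUniqueCenter A S a 1}.indicator (fun _ => (1 : ℝ)) S =
      coreCard A S := by
    simp [coreCard, Set.indicator_apply]
  dsimp only
  by_cases hS : t ≤ coreCard A S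
  · have : 0 ≤ t * {S : Γ → Bool | S 1 = true}.indicator (fun _ => (1 : ℝ)) S :=
      mul_nonneg ht (Set.indicator_nonneg (fun _ _ => zero_le_one) _)
    have h2 (a : Γ) : ({S | IsUniqueCenter A S a 1} ∩ {S | t ≤ coreCard A S}).indicator
        (fun _ => (1 : ℝ)) S = {S | IsUniqueCenter A S a 1}.indicator (fun _ => (1 : ℝ)) S := by
      simp [Set.indicator_apply, hS]
    simp only [h2]
    linarith
  · have h0 : 0 ≤ ∑ a ∈ A, ({S | IsUniqueCenter A S a 1} ∩ {S | t ≤ coreCard A S}).indicator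
        (fun _ => (1 : ℝ)) S :=
      Finset.sum_nonneg fun a _ => Set.indicator_nonneg (fun _ _ => zero_le_one) _
    rw [hsum]
    by_cases h1 : S 1 = true
    · have : {S : Γ → Bool | S 1 = true}.indicator (fun _ => (1 : ℝ)) S = 1 := by
        simp [h1]
      rw [this]
      linarith
    · have : coreCard A S = 0 := by
        simp [coreCard, IsUniqueCenter, h1]
      rw [this]
      simpa [h1] using h0

/-- Mass transport: the probability that the class of the identity is large is at least the
expected size of the core of `A`, restricted to the event that this core is large. -/
lemma sum_real_inter_le [Countable Γ] (p : I) (A : Finset Γ) (t : ℝ) :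
    ∑ a ∈ A, (percolation Γ p).real
        ({S | IsUniqueCenter A S a 1} ∩ {S | t ≤ coreCard A S}) ≤
      (percolation Γ p).real {S | ∃ F : Finset Γ, ↑F ⊆ classOf (centerRel A S) 1 ∧
        t ≤ (F.card : ℝ)} := by
  classical
  have hm (a : Γ) : MeasurableSet ({S | IsUniqueCenter A S a 1} ∩ {S | t ≤ coreCard A S}) :=
    (measurableSet_isUniqueCenter A a 1).inter (measurableSet_le_coreCard A t)
  have hmem {a : Γ} {S : Γ → Bool} (h : S ∈ shiftSet a ⁻¹'
      ({S | IsUniqueCenter A S a 1} ∩ {S | t ≤ coreCard A S})) :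
      IsUniqueCenter A S 1 a⁻¹ := by
    simpa using (isUniqueCenter_shiftSet A S a a 1).1 h.1
  have heq (a : Γ) : (percolation Γ p).real
      ({S | IsUniqueCenter A S a 1} ∩ {S | t ≤ coreCard A S}) = (percolation Γ p).real
      (shiftSet a ⁻¹' ({S | IsUniqueCenter A S a 1} ∩ {S | t ≤ coreCard A S})) := by
    rw [← map_measureReal_apply (measurable_shiftSet a) (hm a), percolation_map_shiftSet]
  rw [Finset.sum_congr rfl fun a _ => heq a, ← measureReal_biUnion_finset
    (fun a _ b _ hab => Set.disjoint_left.2 fun S h h' =>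
      hab (inv_injective ((hmem h).eq (hmem h')))) fun a _ => measurable_shiftSet a (hm a)]
  refine measureReal_mono (Set.iUnion₂_subset fun a _ S hS => ?_)
  refine ⟨(A.filter fun b => IsUniqueCenter A (shiftSet a S) b 1).image fun b => a⁻¹ * b,
    fun y hy => ?_, ?_⟩
  · obtain ⟨b, hb, rfl⟩ := Finset.mem_image.1 (Finset.mem_coe.1 hy)
    refine (mem_classOf_centerRel A S 1 _).2 (Or.inr ⟨a⁻¹, hmem hS, ?_⟩)
    simpa using (isUniqueCenter_shiftSet A S a b 1).1 (Finset.mem_filter.1 hb).2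
  · rw [Finset.card_image_of_injective _ (mul_right_injective a⁻¹)]
    exact hS.2

lemma measurableSet_classOf_subset {X : Type*} [Countable X] (x : X) (B : Set X) :
    MeasurableSet {r : EqRelSpace X | classOf r x ⊆ B} := by
  have : {r : EqRelSpace X | classOf r x ⊆ B} =
      ⋂ y ∈ Bᶜ, {r : EqRelSpace X | r.1 (x, y) = true}ᶜ := by
    ext r
    simp only [classOf, Set.subset_def, Set.mem_ofPred_eq, Set.mem_iInter, Set.mem_compl_iff]
    exact forall_congr' fun y => not_imp_not.symm
  rw [this]
  exact MeasurableSet.biInter (Set.to_countable _) fun y _ => (measurableSet_eq_fun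
    ((measurable_pi_apply (x, y)).comp measurable_subtype_coe) measurable_const).compl

lemma ae_classOf_subset [Countable Γ] {A : Finset Γ} (hA : (1 : Γ) ∈ A) (μ : Measure (Γ → Bool))
    (x : Γ) : ∀ᵐ r ∂μ.map (centerRel A),
      ∃ g : Γ, classOf r x ⊆ (fun y => g * y) '' (↑A : Set Γ) := by
  refine (ae_map_iff (measurable_centerRel A).aemeasurable ?_).2
    (ae_of_all _ fun S => classOf_centerRel_subset hA S x)
  simp only [Set.ofPred_exists]
  exact MeasurableSet.iUnion fun g => measurableSet_classOf_subset x _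

/-- Proposition (tiling construction): for a finite subset `A ∋ e` of `Γ` and `0 < δ < 1/2`
there is a finite IRE whose identity class is a.s. contained in a left translate of `A` and
such that `ρ({r : |[e]_r| ≥ (1−2δ)²|A|}) ≥ (δ − δ²)·4δ²·(1−2δ)²`. The event
`|[e]_r| ≥ (1−2δ)²|A|` is coded as the existence of a finite subset of the class of that
size. -/
theorem FIRE_from_finite_subset
    {Γ : Type*} [Group Γ] [Countable Γ]
    (A : Finset Γ) (hA : (1 : Γ) ∈ A) {δ : ℝ} (hδ0 : 0 < δ) (hδ : δ < 1 / 2) :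
    ∃ ρ : ProbabilityMeasure (EqRelSpace Γ), IsFIRE ρ ∧
      (∀ᵐ r ∂ρ.toMeasure, ∃ g : Γ, classOf r 1 ⊆ (fun x => g * x) '' (↑A : Set Γ)) ∧
      ENNReal.ofReal ((δ - δ ^ 2) * (4 * δ ^ 2) * (1 - 2 * δ) ^ 2) ≤
        ρ.toMeasure {r | ∃ F : Finset Γ, ↑F ⊆ classOf r 1 ∧
          (1 - 2 * δ) ^ 2 * (A.card : ℝ) ≤ (F.card : ℝ)} := by
  have hn : 0 < A.card := Finset.card_pos.2 ⟨1, hA⟩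
  have hn1 : (1 : ℝ) ≤ A.card := by exact_mod_cast hn
  have hp1 : δ / A.card ≤ δ := div_le_self hδ0.le hn1
  let p : I := ⟨δ / A.card, by positivity, by linarith⟩
  have hΦ := measurable_centerRel A
  refine ⟨⟨(percolation Γ p).map (centerRel A),
    Measure.isProbabilityMeasure_map hΦ.aemeasurable⟩, ⟨fun γ => ?_, ?_⟩, ?_, ?_⟩
  · change Measure.map _ (Measure.map _ _) = Measure.map _ _
    rw [Measure.map_map (measurable_shiftE γ) hΦ]
    have : shiftE γ ∘ centerRel A = centerRel A ∘ shiftSet γ :=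
      funext fun S => shiftE_centerRel A γ S
    rw [this, ← Measure.map_map hΦ (measurable_shiftSet γ), percolation_map_shiftSet]
  · refine ae_all_iff.2 fun g => (ae_classOf_subset hA _ g).mono fun r hr => ?_
    obtain ⟨h, hh⟩ := hr
    exact (A.finite_toSet.image _).subset hh
  · exact ae_classOf_subset hA _ 1
  · refine le_trans ?_ (Measure.le_map_apply hΦ.aemeasurable _)
    refine ENNReal.ofReal_le_of_le_toReal ?_
    set t : ℝ := (1 - 2 * δ) ^ 2 * A.card with ht
    have h1 := sum_real_isUniqueCenter_le (percolation Γ p) A (t := t) (by positivity)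
    refine le_trans ?_ (sum_real_inter_le p A t)
    rw [percolation_real_mem, Finset.sum_congr rfl fun a ha => percolation_real_isUniqueCenter p ha,
      Finset.sum_const, nsmul_eq_mul] at h1
    have hnp : (A.card : ℝ) * p = δ := mul_div_cancel₀ _ (by positivity)
    have hp0 : 0 ≤ (p : ℝ) := p.2.1
    have hb : 1 - δ ≤ (1 - p : ℝ) ^ (A.card - 1) := by
      have := one_add_mul_le_pow (a := -(p : ℝ)) (by linarith [p.2.2]) (A.card - 1)
      rw [Nat.cast_sub hn] at this
      push_cast at this
      rw [← sub_eq_add_neg] at this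
      nlinarith
    have hlow : δ * (1 - δ) ≤ A.card * (p * (1 - p : ℝ) ^ (A.card - 1)) := by
      rw [← mul_assoc, hnp]
      gcongr
    have htp : t * p = (1 - 2 * δ) ^ 2 * δ := by rw [ht, mul_assoc, hnp]
    have h4 : 4 * (δ * (1 - δ)) ≤ 1 := by nlinarith [sq_nonneg (1 - 2 * δ)]
    have h5 : (1 - 2 * δ) ^ 2 ≤ 1 := by nlinarith
    have h6 : 4 * (δ * (1 - δ)) * (1 - 2 * δ) ^ 2 ≤ 1 := mul_le_one₀ h4 (sq_nonneg _) h5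
    have h7 : δ ^ 2 * (4 * (δ * (1 - δ)) * (1 - 2 * δ) ^ 2) ≤ δ ^ 2 * (3 - 4 * δ) := by
      gcongr
      linarith
    nlinarith
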